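/- Let n = 4r + q with r ≥ 1 and 0 ≤ q ≤ 3, and let G be a connected graph on n vertices with κ̄₄(G) = 1. Then e(G) ≤ (3n − 2)/2 if q = 0, e(G) ≤ (3n − 3)/2 if q = 1, e(G) ≤ (3n − 4)/2 if q = 2, and e(G) ≤ (3n − 3)/2 if q = 3. -/

import Mathlib

open SimpleGraph

/-- An `S`-Steiner tree in `G`: a subgraph that is a tree and contains `S`. -/
def SimpleGraph.IsSteinerTree {V : Type*} (G : SimpleGraph V) (S : Set V)
    (T : G.Subgraph) : Prop :=
  S ⊆ T.verts ∧ T.coe.IsTree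

/-- `κ(S)`: the maximum number of pairwise internally disjoint `S`-Steiner trees in `G`. -/
noncomputable def SimpleGraph.steinerConn {V : Type*} (G : SimpleGraph V) (S : Set V) : ℕ :=
  sSup {n : ℕ | ∃ f : Fin n → G.Subgraph,
    (∀ i, G.IsSteinerTree S (f i)) ∧
    ∀ i j, i ≠ j →
      (f i).edgeSet ∩ (f j).edgeSet = ∅ ∧ (f i).verts ∩ (f j).verts = S}

/-- `κ̄ₖ(G) = max {κ(S) : S ⊆ V(G), |S| = k}`, the maximal generalized local connectivity. -/
noncomputable def SimpleGraph.kappaBar {V : Type*} (G : SimpleGraph V) (k : ℕ) : ℕ :=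
  sSup {m : ℕ | ∃ S : Finset V, S.card = k ∧ G.steinerConn ↑S = m}

/-- `p` is an ear of the cycle `c` in `G`: a nontrivial path (whose two endpoints may
coincide) meeting `c` exactly in its endpoints. -/
def SimpleGraph.IsEar {V : Type*} (G : SimpleGraph V) {x u v : V}
    (c : G.Walk x x) (p : G.Walk u v) : Prop :=
  0 < p.length ∧ u ∈ c.support ∧ v ∈ c.support ∧
  p.support.tail.Nodup ∧ (u = v ∨ u ∉ p.support.tail) ∧
  ∀ w ∈ p.support, w ∈ c.support → w = u ∨ w = v

namespace SimpleGraph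

variable {V : Type*}

theorem Reachable.exists_adj_boundary {H : SimpleGraph V} {x y : V} (h : H.Reachable x y)
    (P : V → Prop) (hx : P x) (hy : ¬ P y) : ∃ u v, H.Adj u v ∧ P u ∧ ¬ P v := by
  obtain ⟨p⟩ := h
  obtain ⟨d, -, h1, h2⟩ := p.exists_boundary_dart {v | P v} hx hy
  exact ⟨d.fst, d.snd, d.adj, h1, h2⟩

theorem Reachable.of_forall_adj {H K : SimpleGraph V} (hHK : ∀ u v, H.Adj u v → K.Reachable u v)
    {x y : V} (h : H.Reachable x y) : K.Reachable x y := by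
  obtain ⟨p⟩ := h
  induction p with
  | nil => rfl
  | cons h _ ih => exact (hHK _ _ h).trans ih

/-- The edges of `H` in the connected component of `a`. -/
def atRoot (H : SimpleGraph V) (a : V) : SimpleGraph V where
  Adj u v := H.Adj u v ∧ H.Reachable a u
  symm := ⟨fun _ _ h => ⟨h.1.symm, h.2.trans h.1.reachable⟩⟩
  loopless := ⟨fun _ h => h.1.ne rfl⟩

theorem atRoot_le (H : SimpleGraph V) (a : V) : H.atRoot a ≤ H := fun _ _ h => h.1

theorem reachable_atRoot {H : SimpleGraph V} {a v : V} :
    (H.atRoot a).Reachable a v ↔ H.Reachable a v := by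
  refine ⟨fun h => h.mono (H.atRoot_le a), fun h => ?_⟩
  by_contra hv
  obtain ⟨x, y, hxy, hx, hy⟩ :=
    h.exists_adj_boundary (fun v => (H.atRoot a).Reachable a v) (Reachable.refl a) hv
  exact hy (hx.trans (Adj.reachable (G := H.atRoot a) ⟨hxy, hx.mono (H.atRoot_le a)⟩))

theorem atRoot_mono {H K : SimpleGraph V} (h : H ≤ K) (a : V) : H.atRoot a ≤ K.atRoot a :=
  fun _ _ hu => ⟨h hu.1, hu.2.mono h⟩

/-- `H` has an edge `xy` lying on a cycle. -/
def CycleAdj (H : SimpleGraph V) (x y : V) : Prop :=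
  H.Adj x y ∧ (H \ edge x y).Reachable x y

theorem CycleAdj.symm {H : SimpleGraph V} {x y : V} (h : H.CycleAdj x y) : H.CycleAdj y x :=
  ⟨h.1.symm, by rw [edge_comm]; exact h.2.symm⟩

theorem CycleAdj.reachable_iff {H : SimpleGraph V} {x y u v : V} (h : H.CycleAdj x y) :
    (H \ edge x y).Reachable u v ↔ H.Reachable u v := by
  refine ⟨fun h => h.mono sdiff_le, fun h' => h'.of_forall_adj fun s t hst => ?_⟩
  by_cases he : (edge x y).Adj s t
  · rw [edge_adj] at he
    rcases he.1 with ⟨rfl, rfl⟩ | ⟨rfl, rfl⟩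
    · exact h.2
    · exact h.2.symm
  · exact Adj.reachable (G := H \ edge x y) ⟨hst, he⟩

theorem Walk.reachable_of_notMem_support {H K : SimpleGraph V} {z u v : V} (q : H.Walk u v)
    (hz : z ∉ q.support) (hK : ∀ s t, H.Adj s t → s ≠ z → t ≠ z → K.Adj s t) :
    K.Reachable u v := by
  induction q with
  | nil => rfl
  | cons h p ih =>
    simp only [Walk.support_cons, List.mem_cons, not_or] at hz
    exact (hK _ _ h (Ne.symm hz.1) (fun h' => hz.2 (h' ▸ p.start_mem_support))).reachable.trans
      (ih hz.2)

theorem CycleAdj.exists_walk {H : SimpleGraph V} {x y : V} (h : H.CycleAdj x y) :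
    ∃ v, v ≠ y ∧ H.CycleAdj x v ∧ ∃ q : H.Walk v y, x ∉ q.support := by
  classical
  obtain ⟨p, hp⟩ := h.2.exists_isPath
  cases p with
  | nil => exact absurd rfl h.1.ne
  | @cons _ v _ hv q =>
    rw [Walk.cons_isPath_iff] at hp
    have hvy : v ≠ y := by
      rintro rfl
      exact hv.2 (by rw [edge_adj]; exact ⟨.inl ⟨rfl, rfl⟩, h.1.ne⟩)
    refine ⟨v, hvy, ⟨hv.1, ?_⟩, q.mapLe sdiff_le, by simpa using hp.2⟩
    have h1 : (H \ edge x v).Reachable v y := q.reachable_of_notMem_support hp.2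
      fun s t hst hs ht => ⟨hst.1, by rw [edge_adj]; tauto⟩
    have h2 : (H \ edge x v).Adj x y :=
      ⟨h.1, by rw [edge_adj]; have := h.1.ne; grind⟩
    exact h2.reachable.trans h1.symm

/-- Deleting a bridge at `z` keeps the edges at `z` lying on cycles on cycles. -/
theorem CycleAdj.sdiff_bridge {H : SimpleGraph V} {z w z' : V} (h : H.CycleAdj z w)
    (h' : ¬ H.CycleAdj z z') : (H \ edge z z').CycleAdj z w := by
  obtain ⟨v, hv, hzv, q, hq⟩ := h.exists_walk
  have hw : w ≠ z' := fun e => h' (e ▸ h)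
  have hv' : v ≠ z' := fun e => h' (e ▸ hzv)
  have hzw := h.1.ne
  refine ⟨⟨h.1, by rw [edge_adj]; grind⟩, ?_⟩
  have h1 : ((H \ edge z z') \ edge z w).Reachable v w := q.reachable_of_notMem_support hq
    fun s t hst hs ht => ⟨⟨hst, by rw [edge_adj]; tauto⟩, by rw [edge_adj]; tauto⟩
  have h2 : ((H \ edge z z') \ edge z w).Adj z v :=
    ⟨⟨hzv.1, by rw [edge_adj]; have := hzv.1.ne; grind⟩,
      by rw [edge_adj]; have := hzv.1.ne; grind⟩
  exact h2.reachable.trans h1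

theorem Reachable.sdiff_edge {H : SimpleGraph V} {x v : V} (h : H.Reachable x v) (y : V) :
    (H \ edge x y).Reachable x v ∨ (H \ edge x y).Reachable y v := by
  by_contra! hcon
  obtain ⟨s, t, hst, hs, ht⟩ := h.exists_adj_boundary
    (fun v => (H \ edge x y).Reachable x v ∨ (H \ edge x y).Reachable y v)
    (.inl (.refl _)) (by tauto)
  by_cases he : (edge x y).Adj s t
  · rw [edge_adj] at he
    rcases he.1 with ⟨rfl, rfl⟩ | ⟨rfl, rfl⟩
    exacts [ht (.inr (.refl _)), ht (.inl (.refl _))]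
  · have := Adj.reachable (G := H \ edge x y) ⟨hst, he⟩
    exact ht (hs.imp (fun h => h.trans this) fun h => h.trans this)

/-- The component of `a` has a spanning tree. -/
theorem exists_spanning_of_root [Finite V] (H : SimpleGraph V) (a : V) :
    ∃ K ≤ H, (∀ v, H.Reachable a v → K.Reachable a v) ∧
      K.edgeSet.ncard + 1 = {v | H.Reachable a v}.ncard := by
  classical
  have := Fintype.ofFinite V
  let C := H.connectedComponentMk a
  obtain ⟨T, hT, hTt⟩ := C.connected_toSimpleGraph.exists_isTree_le
  refine ⟨T.map (Function.Embedding.subtype _), ?_, ?_, ?_⟩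
  · rw [map_le_iff_le_comap]
    intro u v h
    exact hT h
  · intro v hv
    have ha : a ∈ C := rfl
    have hv' : v ∈ C := ConnectedComponent.sound hv.symm
    exact (hTt.1 ⟨a, ha⟩ ⟨v, hv'⟩).map (Embedding.map (Function.Embedding.subtype _) T).toHom
  · have h1 := hTt.card_edgeFinset
    rw [← Set.ncard_coe_finset, coe_edgeFinset] at h1
    rw [← coe_edgeFinset, Set.ncard_coe_finset, card_edgeFinset_map, ← Set.ncard_coe_finset,
      coe_edgeFinset, h1, ← Nat.card_eq_fintype_card]
    change Nat.card {v // v ∈ C} = _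
    rw [← Nat.card_coe_set_eq]
    congr! 3 with v
    exact ConnectedComponent.eq.trans ⟨Reachable.symm, Reachable.symm⟩

/-- A component with at least as many edges as vertices has an edge on a cycle. -/
theorem exists_cycleAdj [Finite V] (H : SimpleGraph V) (a : V)
    (h : {v | H.Reachable a v}.ncard ≤ (H.atRoot a).edgeSet.ncard) :
    ∃ x y, H.Reachable a x ∧ H.CycleAdj x y := by
  obtain ⟨K, hK, hr, hc⟩ := H.exists_spanning_of_root a
  have : ¬ (H.atRoot a) ≤ K := fun hle => by
    have := Set.ncard_le_ncard (edgeSet_mono hle) (Set.toFinite _)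
    omega
  rw [le_iff_adj] at this
  push Not at this
  obtain ⟨x, y, hxy, hn⟩ := this
  refine ⟨x, y, hxy.2, hxy.1, ?_⟩
  have : K ≤ H \ edge x y := fun u v huv => ⟨hK huv, fun he => by
    rw [edge_adj] at he
    rcases he.1 with ⟨rfl, rfl⟩ | ⟨rfl, rfl⟩
    exacts [hn huv, hn huv.symm]⟩
  exact ((hr x hxy.2).symm.trans (hr y (hxy.2.trans hxy.1.reachable))).mono this


/-- The vertices joined to `b` in both `R` and `B`. -/
def commonReach (R B : SimpleGraph V) (b : V) : Set V :=
  {v | R.Reachable b v ∧ B.Reachable b v}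

theorem commonReach_comm (R B : SimpleGraph V) (b : V) :
    commonReach R B b = commonReach B R b := by
  ext; exact and_comm

/-- `R` and `B` are edge-disjoint subgraphs of `H`, and `b` is in the component of `a`. -/
structure IsSplit (H : SimpleGraph V) (a : V) (R B : SimpleGraph V) (b : V) : Prop where
  left_le : R ≤ H
  right_le : B ≤ H
  not_adj : ∀ u v, R.Adj u v → ¬ B.Adj u v
  reach : H.Reachable a b

theorem IsSplit.symm {H R B : SimpleGraph V} {a b : V} (h : H.IsSplit a R B b) :
    H.IsSplit a B R b :=
  ⟨h.right_le, h.left_le, fun u v hu hv => h.not_adj u v hv hu, h.reach⟩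

/-- A split with the largest number of common vertices. -/
structure IsMaxSplit (H : SimpleGraph V) (a : V) (R B : SimpleGraph V) (b : V) : Prop
    extends H.IsSplit a R B b where
  max : ∀ R' B' b', H.IsSplit a R' B' b' →
    (commonReach R' B' b').ncard ≤ (commonReach R B b).ncard

theorem IsMaxSplit.symm {H R B : SimpleGraph V} {a b : V} (h : H.IsMaxSplit a R B b) :
    H.IsMaxSplit a B R b :=
  ⟨h.toIsSplit.symm, fun R' B' b' h' => by rw [commonReach_comm B R]; exact h.max R' B' b' h'⟩

theorem IsMaxSplit.of_subset [Finite V] {H R B R' B' : SimpleGraph V} {a b b' : V}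
    (h : H.IsMaxSplit a R B b) (h' : H.IsSplit a R' B' b')
    (hs : commonReach R B b ⊆ commonReach R' B' b') : H.IsMaxSplit a R' B' b' :=
  ⟨h', fun R'' B'' b'' h'' =>
    (h.max R'' B'' b'' h'').trans (Set.ncard_le_ncard hs (Set.toFinite _))⟩

theorem IsMaxSplit.eq_of_subset [Finite V] {H R B R' B' : SimpleGraph V} {a b b' : V}
    (h : H.IsMaxSplit a R B b) (h' : H.IsSplit a R' B' b')
    (hs : commonReach R B b ⊆ commonReach R' B' b') :
    commonReach R B b = commonReach R' B' b' :=
  Set.eq_of_subset_of_ncard_le hs (h.max _ _ _ h') (Set.toFinite _)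

theorem IsSplit.recolour {H R B : SimpleGraph V} {a b u v : V} (h : H.IsSplit a R B b)
    (huv : R.Adj u v) : H.IsSplit a (R \ edge u v) (B ⊔ edge u v) b := by
  refine ⟨sdiff_le.trans h.left_le, sup_le h.right_le ?_, ?_, h.reach⟩
  · intro s t hst
    rw [edge_adj] at hst
    rcases hst.1 with ⟨rfl, rfl⟩ | ⟨rfl, rfl⟩
    exacts [h.left_le huv, h.left_le huv.symm]
  · rintro s t hst (h1 | h1)
    · exact h.not_adj _ _ hst.1 h1
    · exact hst.2 h1

theorem CycleAdj.commonReach_recolour {R B : SimpleGraph V} {b u v : V}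
    (huv : R.CycleAdj u v) :
    commonReach R B b ⊆ commonReach (R \ edge u v) (B ⊔ edge u v) b :=
  fun _ hx => ⟨huv.reachable_iff.2 hx.1, hx.2.mono le_sup_left⟩

theorem edge_adj_self_left {u v : V} (h : u ≠ v) : (edge u v).Adj u v := by
  rw [edge_adj]; exact ⟨.inl ⟨rfl, rfl⟩, h⟩

theorem IsMaxSplit.mem_of_cycleAdj [Finite V] {H R B : SimpleGraph V} {a b u v : V}
    (h : H.IsMaxSplit a R B b) (hu : u ∈ commonReach R B b) (huv : R.CycleAdj u v) :
    v ∈ commonReach R B b := by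
  rw [h.eq_of_subset (h.toIsSplit.recolour huv.1) huv.commonReach_recolour]
  refine ⟨huv.reachable_iff.2 (hu.1.trans huv.1.reachable), ?_⟩
  exact (hu.2.mono le_sup_left).trans
    (Adj.reachable (G := B ⊔ edge u v) (.inr (edge_adj_self_left huv.1.ne)))

theorem IsMaxSplit.not_cycleAdj [Finite V] {H R B : SimpleGraph V} {a b u v : V}
    (h : H.IsMaxSplit a R B b) (h3 : (commonReach R B b).ncard ≤ 3)
    (hu : u ∈ commonReach R B b) : ¬ R.CycleAdj u v := by
  intro huv
  have hv := h.mem_of_cycleAdj hu huv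
  obtain ⟨x, hxv, hux, -⟩ := huv.exists_walk
  have hx := h.mem_of_cycleAdj hu hux
  have hsp := h.toIsSplit.recolour huv.1
  have heq := h.eq_of_subset hsp huv.commonReach_recolour
  have hmax := (h.of_subset hsp huv.commonReach_recolour).symm
  have hB : (B ⊔ edge u v).CycleAdj u v := by
    refine ⟨.inr (edge_adj_self_left huv.1.ne), (hu.2.symm.trans hv.2).mono ?_⟩
    refine le_sdiff.2 ⟨le_sup_left, ?_⟩
    rw [disjoint_left]
    intro s t hst he
    rw [edge_adj] at he
    rcases he.1 with ⟨rfl, rfl⟩ | ⟨rfl, rfl⟩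
    exacts [h.not_adj _ _ huv.1 hst, h.not_adj _ _ huv.1.symm hst]
  obtain ⟨y, hyv, huy, -⟩ := hB.exists_walk
  have hy : y ∈ commonReach R B b := by
    rw [heq, commonReach_comm]
    exact hmax.mem_of_cycleAdj (by rw [commonReach_comm, ← heq]; exact hu) huy
  have hBy : B.Adj u y := by
    rcases huy.1 with h1 | h1
    · exact h1
    · rw [edge_adj] at h1
      have := huv.1.ne
      grind
  have hxy : x ≠ y := fun e => h.not_adj _ _ hux.1 (e ▸ hBy)
  have hsub : ({u, v, x, y} : Set V) ⊆ commonReach R B b := by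
    rintro t (rfl | rfl | rfl | rfl) <;> assumption
  have hc : ({u, v, x, y} : Set V).ncard = 4 := by
    have h1 := huv.1.ne
    have h2 := hux.1.ne
    have h3 := hBy.ne
    rw [Set.ncard_insert_of_notMem (by simp; tauto), Set.ncard_insert_of_notMem (by simp; tauto),
      Set.ncard_pair hxy]
  have := Set.ncard_le_ncard hsub (Set.toFinite _)
  omega

/-- If `R` contains edge-disjoint `X` and `Y` that both join `z` to `w` and together join `z`
to all common vertices, some to each, then there are at least four common vertices. -/
theorem IsMaxSplit.exchange_aux [Finite V] {H R B X Y : SimpleGraph V} {a b z w : V}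
    (h : H.IsMaxSplit a R B b) (hX : X ≤ R) (hY : Y ≤ R) (hXY : ∀ u v, X.Adj u v → ¬ Y.Adj u v)
    (hz : R.Reachable b z) (hzw : z ≠ w) (hzc : z ∉ commonReach R B b)
    (hwc : w ∉ commonReach R B b) (hXw : X.Reachable z w) (hYw : Y.Reachable z w)
    (hYb : ∃ v ∈ commonReach R B b, Y.Reachable z v) :
    {v ∈ commonReach R B b | X.Reachable z v}.ncard + 2 ≤ (commonReach R B b).ncard := by
  obtain ⟨c, hc, hYc⟩ := hYb
  have hsp : H.IsSplit a X (B ⊔ Y) z := by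
    refine ⟨hX.trans h.left_le, sup_le h.right_le (hY.trans h.left_le), ?_,
      h.reach.trans (hz.mono h.left_le)⟩
    rintro s t hst (h1 | h1)
    · exact h.not_adj _ _ (hX hst) h1
    · exact hXY _ _ hst h1
  refine le_trans ?_ (h.max _ _ _ hsp)
  have : insert z (insert w {v ∈ commonReach R B b | X.Reachable z v}) ⊆
      commonReach X (B ⊔ Y) z := by
    rintro t (rfl | rfl | ht)
    · exact ⟨.refl _, .refl _⟩
    · exact ⟨hXw, hYw.mono le_sup_right⟩
    · exact ⟨ht.2, (hYc.mono le_sup_right).trans ((hc.2.symm.trans ht.1.2).mono le_sup_left)⟩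
  refine le_trans (Eq.ge ?_) (Set.ncard_le_ncard this (Set.toFinite _))
  rw [Set.ncard_insert_of_notMem, Set.ncard_insert_of_notMem]
  · exact fun h' => hwc h'.1
  · rintro (h' | h')
    exacts [hzw h', hzc h'.1]

theorem IsMaxSplit.exchange [Finite V] {H R B X Y : SimpleGraph V} {a b z w : V}
    (h : H.IsMaxSplit a R B b) (hX : X ≤ R) (hY : Y ≤ R) (hXY : ∀ u v, X.Adj u v → ¬ Y.Adj u v)
    (hz : R.Reachable b z) (hzw : z ≠ w) (hzc : z ∉ commonReach R B b)
    (hwc : w ∉ commonReach R B b) (hXw : X.Reachable z w) (hYw : Y.Reachable z w)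
    (hXb : ∃ v ∈ commonReach R B b, X.Reachable z v)
    (hYb : ∃ v ∈ commonReach R B b, Y.Reachable z v)
    (hc : ∀ v ∈ commonReach R B b, X.Reachable z v ∨ Y.Reachable z v) :
    4 ≤ (commonReach R B b).ncard := by
  have h1 := h.exchange_aux hX hY hXY hz hzw hzc hwc hXw hYw hYb
  have h2 := h.exchange_aux hY hX (fun u v hu hv => hXY u v hv hu) hz hzw hzc hwc hYw hXw hXb
  have h3 : commonReach R B b ⊆ {v ∈ commonReach R B b | X.Reachable z v} ∪
      {v ∈ commonReach R B b | Y.Reachable z v} :=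
    fun v hv => (hc v hv).imp (fun h => ⟨hv, h⟩) fun h => ⟨hv, h⟩
  have h4 := (Set.ncard_le_ncard h3 (Set.toFinite _)).trans (Set.ncard_union_le _ _)
  omega

/-- Every edge of `H` is an edge of the component of `b` in `R` or in `B`. -/
def IsFullSplit (H R B : SimpleGraph V) (b : V) : Prop :=
  ∀ u v, H.Adj u v → (R.Adj u v ∧ R.Reachable b u) ∨ (B.Adj u v ∧ B.Reachable b u)

theorem IsMaxSplit.not_cycleAdj_of_full [Finite V] {H R B : SimpleGraph V} {a b x y : V}
    (h : H.IsMaxSplit a R B b) (h3 : (commonReach R B b).ncard ≤ 3)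
    (hfull : H.IsFullSplit R B b) (hH : ∀ u v, H.Adj u v → H.CycleAdj u v)
    (hx : R.Reachable b x) : ¬ R.CycleAdj x y := by
  intro hxy
  obtain ⟨z, z', ⟨hzz', hbz⟩, ⟨w, hzw⟩, hz'⟩ :=
    (reachable_atRoot.2 hx).symm.exists_adj_boundary (fun v => ∃ w, R.CycleAdj v w)
    ⟨y, hxy⟩ (fun ⟨w, hw⟩ => h.not_cycleAdj h3 ⟨.refl _, .refl _⟩ hw)
  have hnb : ¬ (R \ edge z z').Reachable z z' := fun hr => hz' ⟨z, CycleAdj.symm ⟨hzz', hr⟩⟩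
  have hzw' : (R \ edge z z').CycleAdj z w := hzw.sdiff_bridge fun hc => hz' ⟨z, hc.symm⟩
  have hzz'' := h.left_le hzz'
  set F := R \ edge z z'
  have hadj : ∀ u v, R.Adj u v → ¬ (edge z z').Adj u v → F.Adj u v := fun u v h1 h2 => ⟨h1, h2⟩
  have hcov : ∀ v, R.Reachable z v → F.Reachable z v ∨ F.Reachable z' v := fun v hv =>
    hv.sdiff_edge z'
  have hexit : ∀ u u', (H \ edge z z').Reachable u u' → R.Reachable b u → ¬ F.Reachable u u' →
      ∃ v ∈ commonReach R B b, F.Reachable u v := by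
    intro u u' hu hbu hn
    obtain ⟨s, t, hst, hs, ht⟩ := hu.exists_adj_boundary (fun v => F.Reachable u v) (.refl _) hn
    rcases hfull s t hst.1 with h1 | h1
    · exact absurd (hs.trans (hadj s t h1.1 hst.2).reachable) ht
    · exact ⟨s, ⟨hbu.trans (hs.mono sdiff_le), h1.2⟩, hs⟩
  have hXr : ∀ {v}, ((F \ edge z w).atRoot z).Reachable z v ↔ F.Reachable z v :=
    reachable_atRoot.trans hzw'.reachable_iff
  have hYr : ∀ {v}, F.Reachable z' v →
      (F.atRoot z' ⊔ edge z z' ⊔ edge z w).Reachable z v := fun {v} hv =>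
    (Adj.reachable (G := F.atRoot z' ⊔ edge z z' ⊔ edge z w)
      (.inl (.inr (edge_adj_self_left hzz'.ne)))).trans
      ((reachable_atRoot.2 hv).mono (le_sup_left.trans le_sup_left))
  have hedge : ∀ {s t}, R.Adj s t → edge s t ≤ R := by
    intro s t hst u v huv
    rw [edge_adj] at huv
    rcases huv.1 with ⟨rfl, rfl⟩ | ⟨rfl, rfl⟩
    exacts [hst, hst.symm]
  have hout : ∀ {s t}, R.CycleAdj s t → s ∉ commonReach R B b := fun hst hs =>
    h.not_cycleAdj h3 hs hst
  have h4 := h.exchange (X := (F \ edge z w).atRoot z) (Y := F.atRoot z' ⊔ edge z z' ⊔ edge z w)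
    (((F \ edge z w).atRoot_le z).trans (sdiff_le.trans sdiff_le))
    (sup_le (sup_le ((F.atRoot_le z').trans sdiff_le) (hedge hzz')) (hedge hzw.1))
    (by
      rintro u v hX ((hY | hY) | hY)
      · exact hnb ((hX.2.mono sdiff_le).trans hY.2.symm)
      · exact hX.1.1.2 hY
      · exact hX.1.2 hY)
    hbz hzw.1.ne (hout hzw) (hout hzw.symm) (hXr.2 hzw'.1.reachable)
    (Adj.reachable (G := F.atRoot z' ⊔ edge z z' ⊔ edge z w)
      (.inr (edge_adj_self_left hzw.1.ne)))
    (by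
      obtain ⟨v, hv, hzv⟩ := hexit z z' (hH _ _ hzz'').2 hbz hnb
      exact ⟨v, hv, hXr.2 hzv⟩)
    (by
      obtain ⟨v, hv, hzv⟩ := hexit z' z (hH _ _ hzz'').2.symm (hbz.trans hzz'.reachable)
        fun h => hnb h.symm
      exact ⟨v, hv, hYr hzv⟩)
    fun v hv => (hcov v (hbz.symm.trans hv.1)).imp hXr.2 hYr
  omega

theorem IsMaxSplit.exists_more_edges [Finite V] {H R B : SimpleGraph V} {a b x y : V}
    (h : H.IsMaxSplit a R B b) (hxy : H.Adj x y) (hx : R.Reachable b x) (hR : ¬ R.Adj x y)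
    (hB : ¬ (B.Adj x y ∧ B.Reachable b x)) : ∃ R' B', H.IsMaxSplit a R' B' b ∧
      (R.atRoot b).edgeSet.ncard + (B.atRoot b).edgeSet.ncard <
        (R'.atRoot b).edgeSet.ncard + (B'.atRoot b).edgeSet.ncard := by
  have hle : R ≤ R ⊔ edge x y := le_sup_left
  have hB' : ∀ {v}, B.Reachable b v → (B.atRoot b).Reachable b v := reachable_atRoot.2
  refine ⟨R ⊔ edge x y, B.atRoot b, h.of_subset ⟨sup_le h.left_le ?_,
    (B.atRoot_le b).trans h.right_le, ?_, h.reach⟩ fun v hv => ⟨hv.1.mono hle, hB' hv.2⟩, ?_⟩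
  · intro u v huv
    rw [edge_adj] at huv
    rcases huv.1 with ⟨rfl, rfl⟩ | ⟨rfl, rfl⟩
    exacts [hxy, hxy.symm]
  · rintro u v (h1 | h1) h2
    · exact h.not_adj _ _ h1 h2.1
    · rw [edge_adj] at h1
      rcases h1.1 with ⟨rfl, rfl⟩ | ⟨rfl, rfl⟩
      exacts [hB h2, hB ⟨h2.1.symm, h2.2.trans h2.1.reachable⟩]
  · refine add_lt_add_of_lt_of_le (Set.ncard_lt_ncard ?_ (Set.toFinite _))
      (Set.ncard_le_ncard (edgeSet_mono fun u v huv => ⟨huv, hB' huv.2⟩) (Set.toFinite _))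
    refine ssubset_of_subset_of_ne (edgeSet_mono (atRoot_mono hle b)) fun he => hR ?_
    have : ((R ⊔ edge x y).atRoot b).Adj x y :=
      ⟨.inr (edge_adj_self_left hxy.ne), hx.mono hle⟩
    rw [← mem_edgeSet, ← he, mem_edgeSet] at this
    exact this.1

theorem exists_isMaxSplit_isFullSplit [Finite V] {H : SimpleGraph V} {a : V}
    (hH : ∀ u v, H.Adj u v → H.Reachable a u) :
    ∃ R B b, H.IsMaxSplit a R B b ∧ H.IsFullSplit R B b := by
  obtain ⟨⟨R₀, B₀, b₀⟩, h₀, hm₀⟩ := Set.exists_max_image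
    {p : SimpleGraph V × SimpleGraph V × V | H.IsSplit a p.1 p.2.1 p.2.2}
    (fun p => (commonReach p.1 p.2.1 p.2.2).ncard) (Set.toFinite _)
    ⟨(⊥, ⊥, a), ⟨bot_le, bot_le, by simp, .refl _⟩⟩
  have hmax₀ : H.IsMaxSplit a R₀ B₀ b₀ := ⟨h₀, fun R B b h => hm₀ (R, B, b) h⟩
  obtain ⟨⟨R, B, b⟩, h, hm⟩ := Set.exists_max_image
    {p : SimpleGraph V × SimpleGraph V × V | H.IsMaxSplit a p.1 p.2.1 p.2.2}
    (fun p => (p.1.atRoot p.2.2).edgeSet.ncard + (p.2.1.atRoot p.2.2).edgeSet.ncard)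
    (Set.toFinite _) ⟨(R₀, B₀, b₀), hmax₀⟩
  change H.IsMaxSplit a R B b at h
  refine ⟨R, B, b, h, ?_⟩
  by_contra hcon
  rw [IsFullSplit] at hcon
  push Not at hcon
  obtain ⟨x, y, hxy, hn⟩ := hcon
  obtain ⟨s, t, hst, hs, hn1, hn2⟩ : ∃ s t, H.Adj s t ∧ (R.Reachable b s ∨ B.Reachable b s) ∧
      ¬ (R.Adj s t ∧ R.Reachable b s) ∧ ¬ (B.Adj s t ∧ B.Reachable b s) := by
    by_cases hx : R.Reachable b x ∨ B.Reachable b x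
    · exact ⟨x, y, hxy, hx, fun h => hn.1 h.1 h.2, fun h => hn.2 h.1 h.2⟩
    · obtain ⟨s, t, hst, hs, ht⟩ := (h.reach.symm.trans (hH x y hxy)).exists_adj_boundary
        (fun v => R.Reachable b v ∨ B.Reachable b v) (.inl (.refl _)) hx
      exact ⟨s, t, hst, hs, fun h => ht (.inl (h.2.trans h.1.reachable)),
        fun h => ht (.inr (h.2.trans h.1.reachable))⟩
  rcases hs with hs | hs
  · obtain ⟨R', B', h', hlt⟩ := h.exists_more_edges hst hs (fun h => hn1 ⟨h, hs⟩) hn2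
    exact (hm (R', B', b) h').not_gt hlt
  · obtain ⟨R', B', h', hlt⟩ := h.symm.exists_more_edges hst hs (fun h => hn2 ⟨h, hs⟩) hn1
    have := hm (R', B', b) h'
    simp only at this
    omega

/-- A bridgeless component with cyclomatic number at least three contains two edge-disjoint
connected subgraphs with four common vertices. -/
theorem exists_isSplit_of_bridgeless [Finite V] {H : SimpleGraph V} {a : V}
    (hH : ∀ u v, H.Adj u v → H.Reachable a u) (hbr : ∀ u v, H.Adj u v → H.CycleAdj u v)
    (hc : {v | H.Reachable a v}.ncard + 2 ≤ H.edgeSet.ncard) :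
    ∃ R B b, H.IsSplit a R B b ∧ 4 ≤ (commonReach R B b).ncard := by
  obtain ⟨R, B, b, h, hfull⟩ := exists_isMaxSplit_isFullSplit hH
  refine ⟨R, B, b, h.toIsSplit, ?_⟩
  by_contra! h4
  have h3 : (commonReach R B b).ncard ≤ 3 := by omega
  have hR : (R.atRoot b).edgeSet.ncard < {v | R.Reachable b v}.ncard := by
    by_contra! hle
    obtain ⟨x, y, hx, hxy⟩ := R.exists_cycleAdj b hle
    exact h.not_cycleAdj_of_full h3 hfull hbr hx hxy
  have hB : (B.atRoot b).edgeSet.ncard < {v | B.Reachable b v}.ncard := by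
    by_contra! hle
    obtain ⟨x, y, hx, hxy⟩ := B.exists_cycleAdj b hle
    exact h.symm.not_cycleAdj_of_full (by rwa [commonReach_comm])
      (fun u v huv => (hfull u v huv).symm) hbr hx hxy
  have hE : H.edgeSet ⊆ (R.atRoot b).edgeSet ∪ (B.atRoot b).edgeSet := fun e => by
    induction e with
    | h u v => exact hfull u v
  have hE' := (Set.ncard_le_ncard hE (Set.toFinite _)).trans (Set.ncard_union_le _ _)
  have hV : {v | R.Reachable b v} ∪ {v | B.Reachable b v} ⊆ {v | H.Reachable a v} := by
    rintro v (hv | hv)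
    exacts [h.reach.trans (hv.mono h.left_le), h.reach.trans (hv.mono h.right_le)]
  have hV' := Set.ncard_le_ncard hV (Set.toFinite _)
  have hi := Set.ncard_union_add_ncard_inter {v | R.Reachable b v} {v | B.Reachable b v}
  have : {v | R.Reachable b v} ∩ {v | B.Reachable b v} = commonReach R B b := rfl
  rw [this] at hi
  omega

theorem ncard_edgeSet_le_choose [Finite V] {H : SimpleGraph V} {W : Set V}
    (hH : ∀ u v, H.Adj u v → u ∈ W) : H.edgeSet.ncard ≤ W.ncard.choose 2 := by
  classical
  have := Fintype.ofFinite V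
  rw [Set.ncard_eq_toFinset_card' W, ← Sym2.card_image_offDiag, ← Set.ncard_coe_finset]
  refine Set.ncard_le_ncard (fun e => ?_) (Set.toFinite _)
  induction e with
  | h u v =>
    intro he
    rw [mem_edgeSet] at he
    simp only [Finset.coe_image, Set.mem_image]
    exact ⟨(u, v), by simp [hH _ _ he, hH _ _ he.symm, he.ne], rfl⟩

/-- The edge bound for a component without two edge-disjoint connected subgraphs that have
four common vertices. -/
theorem ncard_edgeSet_atRoot_le [Finite V] {G : SimpleGraph V}
    (hG : ∀ R B b, G.IsSplit b R B b → (commonReach R B b).ncard ≤ 3) (H : SimpleGraph V)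
    (a : V) (hle : H ≤ G) (hH : ∀ u v, H.Adj u v → H.Reachable a u) :
    H.edgeSet.ncard + 1 ≤ {v | H.Reachable a v}.ncard + 2 * ({v | H.Reachable a v}.ncard / 4) +
      {v | H.Reachable a v}.ncard % 4 / 3 := by
  induction hm : H.edgeSet.ncard using Nat.strong_induction_on generalizing H a with
  | _ m ih =>
  subst hm
  by_cases hbr : ∀ u v, H.Adj u v → H.CycleAdj u v
  · have hpos : 0 < {v | H.Reachable a v}.ncard :=
      (Set.ncard_pos (Set.toFinite _)).2 ⟨a, .refl _⟩
    by_cases h4 : 4 ≤ {v | H.Reachable a v}.ncard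
    · by_contra! hlt
      obtain ⟨R, B, b, h, hc⟩ := exists_isSplit_of_bridgeless hH hbr (by omega)
      have := hG R B b ⟨h.left_le.trans hle, h.right_le.trans hle, h.not_adj, .refl _⟩
      omega
    · have := ncard_edgeSet_le_choose hH
      change H.edgeSet.ncard ≤ {v | H.Reachable a v}.ncard.choose 2 at this
      generalize {v | H.Reachable a v}.ncard = N at *
      interval_cases N <;> simp [Nat.choose] at this ⊢ <;> omega
  · push Not at hbr
    obtain ⟨x, y, hxy, hn⟩ := hbr
    have hx := hH x y hxy
    have hsub : ∀ z, (H \ edge x y).atRoot z ≤ H := fun z => (atRoot_le _ z).trans sdiff_le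
    have hlt : ∀ z, ((H \ edge x y).atRoot z).edgeSet.ncard < H.edgeSet.ncard := fun z => by
      refine Set.ncard_lt_ncard (ssubset_of_subset_of_ne (edgeSet_mono (hsub z)) fun he => ?_)
        (Set.toFinite _)
      have : s(x, y) ∈ H.edgeSet := hxy
      rw [← he] at this
      exact this.1.2 (edge_adj_self_left hxy.ne)
    have key : ∀ z, _ := fun z => ih _ (hlt z) _ z ((hsub z).trans hle)
      (fun u v huv => reachable_atRoot.2 huv.2) rfl
    simp only [reachable_atRoot] at key
    have h1 := key x
    have h2 := key y
    have hE : H.edgeSet ⊆ insert s(x, y) (((H \ edge x y).atRoot x).edgeSet ∪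
        ((H \ edge x y).atRoot y).edgeSet) := fun e => by
      induction e with
      | h u v =>
        intro huv
        by_cases he : (edge x y).Adj u v
        · rw [adj_edge] at he
          exact .inl he.1.symm
        · exact .inr ((hx.symm.trans (hH u v huv)).sdiff_edge y |>.imp
            (fun h => ⟨⟨huv, he⟩, h⟩) fun h => ⟨⟨huv, he⟩, h⟩)
    have hE1 := (Set.ncard_le_ncard hE (Set.toFinite _)).trans (Set.ncard_insert_le _ _)
    have hE2 := Set.ncard_union_le ((H \ edge x y).atRoot x).edgeSet
      ((H \ edge x y).atRoot y).edgeSet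
    have hd : Disjoint {v | (H \ edge x y).Reachable x v} {v | (H \ edge x y).Reachable y v} :=
      Set.disjoint_left.2 fun v h1 h2 => hn ⟨hxy, Reachable.trans h1 (Reachable.symm h2)⟩
    have hV : {v | (H \ edge x y).Reachable x v} ∪ {v | (H \ edge x y).Reachable y v} ⊆
        {v | H.Reachable a v} := by
      rintro v (hv | hv)
      exacts [hx.trans (hv.mono sdiff_le), hx.trans (hxy.reachable.trans (hv.mono sdiff_le))]
    have hV' := Set.ncard_le_ncard hV (Set.toFinite _)
    rw [Set.ncard_union_eq hd] at hV'
    omega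

/-- The component of `b` in `R ≤ G`, as a subgraph of `G`. -/
def rootSubgraph {G R : SimpleGraph V} (h : R ≤ G) (b : V) : G.Subgraph where
  verts := {v | R.Reachable b v}
  Adj := (R.atRoot b).Adj
  adj_sub h' := h h'.1
  edge_vert h' := h'.2
  symm := (R.atRoot b).symm

theorem rootSubgraph_connected {G R : SimpleGraph V} (h : R ≤ G) (b : V) :
    (rootSubgraph h b).Connected := by
  rw [Subgraph.connected_iff', connected_iff_exists_forall_reachable]
  refine ⟨⟨b, Reachable.refl b⟩, fun ⟨v, hv⟩ => ?_⟩
  by_contra hn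
  have hb : R.Reachable b v := hv
  obtain ⟨s, t, hst, ⟨hs, hs'⟩, ht⟩ := hb.exists_adj_boundary
    (fun v => ∃ hv : v ∈ (rootSubgraph h b).verts,
      (rootSubgraph h b).coe.Reachable ⟨b, Reachable.refl b⟩ ⟨v, hv⟩)
    ⟨Reachable.refl b, .refl _⟩ (fun ⟨_, h'⟩ => hn h')
  refine ht ⟨Reachable.trans hs hst.reachable, hs'.trans (Adj.reachable ?_)⟩
  exact ⟨hst, hs⟩

namespace Subgraph

theorem Connected.exists_isTree_le {G : SimpleGraph V} {P : G.Subgraph} (hP : P.Connected) :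
    ∃ T ≤ P, T.verts = P.verts ∧ T.coe.IsTree := by
  obtain ⟨T, hT, hTt⟩ := hP.coe.exists_isTree_le
  let T' : G.Subgraph :=
    { verts := P.verts
      Adj := fun u v => ∃ hu hv, T.Adj ⟨u, hu⟩ ⟨v, hv⟩
      adj_sub := fun ⟨_, _, h⟩ => P.adj_sub (hT h)
      edge_vert := fun ⟨hu, _, _⟩ => hu
      symm := ⟨fun _ _ ⟨hu, hv, h⟩ => ⟨hv, hu, h.symm⟩⟩ }
  refine ⟨T', ⟨le_rfl, fun _ _ ⟨_, _, h⟩ => hT h⟩, rfl, ?_⟩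
  have : T'.coe = T := by
    ext ⟨u, hu⟩ ⟨v, hv⟩
    exact ⟨fun ⟨_, _, h⟩ => h, fun h => ⟨hu, hv, h⟩⟩
  rw [this]
  exact hTt

/-- A connected subgraph can be pruned to meet a given set in exactly `k` vertices. -/
theorem Connected.exists_le_ncard_inter_eq [Finite V] {G : SimpleGraph V} {k : ℕ} (hk : 1 ≤ k)
    (W : Set V) {P : G.Subgraph} (hP : P.Connected) (hW : k ≤ (P.verts ∩ W).ncard) :
    ∃ Q ≤ P, Q.Connected ∧ (Q.verts ∩ W).ncard = k := by
  induction hm : P.verts.ncard using Nat.strong_induction_on generalizing P with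
  | _ m ih =>
  subst hm
  obtain heq | hlt := hW.eq_or_lt
  · exact ⟨P, le_rfl, hP, heq.symm⟩
  have hnt : Nontrivial P.verts := by
    rw [Set.nontrivial_coe_sort, ← Set.one_lt_ncard_iff_nontrivial]
    exact (hk.trans_lt hlt).trans_le (Set.ncard_le_ncard Set.inter_subset_left (Set.toFinite _))
  obtain ⟨⟨v, hv⟩, hc⟩ := hP.coe.exists_connected_induce_compl_singleton_of_finite_nontrivial
  have hc' : (P.deleteVerts {v}).Connected := by
    rw [Subgraph.connected_iff', (coeDeleteVertsIso {v}).connected_iff]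
    convert hc using 2
    all_goals ext x; simp [Subtype.ext_iff]
  have hlt' : (P.deleteVerts {v}).verts.ncard < P.verts.ncard :=
    Set.ncard_sdiff_singleton_lt_of_mem hv (Set.toFinite _)
  have he : (P.deleteVerts {v}).verts ∩ W = (P.verts ∩ W) \ {v} := by
    rw [deleteVerts_verts]
    ext
    simp only [Set.mem_inter_iff, Set.mem_sdiff]
    tauto
  have hk' : k ≤ ((P.deleteVerts {v}).verts ∩ W).ncard := by
    rw [he]
    have := Set.pred_ncard_le_ncard_sdiff_singleton (P.verts ∩ W) v
    omega
  obtain ⟨Q, hQ, h⟩ := ih _ hlt' hc' hk' rfl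
  exact ⟨Q, hQ.trans deleteVerts_le, h⟩

end Subgraph

theorem le_steinerConn [Finite V] {G : SimpleGraph V} {S : Set V} (hS : S.Nontrivial) {n : ℕ}
    {f : Fin n → G.Subgraph} (hf : ∀ i, G.IsSteinerTree S (f i))
    (hd : ∀ i j, i ≠ j → (f i).edgeSet ∩ (f j).edgeSet = ∅ ∧ (f i).verts ∩ (f j).verts = S) :
    n ≤ G.steinerConn S := by
  refine le_csSup ⟨Nat.card G.Subgraph, ?_⟩ ⟨f, hf, hd⟩
  rintro m ⟨g, hg, hgd⟩
  have hinj : Function.Injective g := by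
    intro i j hij
    by_contra hne
    have he := (hgd i j hne).1
    rw [← hij, Set.inter_self] at he
    obtain ⟨u, hu⟩ := hS.nonempty
    have := (hS.mono (hg i).1).coe_sort
    obtain ⟨v, hv⟩ := Subgraph.Preconnected.exists_adj_of_nontrivial
      (Subgraph.preconnected_iff.2 (hg i).2.1.preconnected) ⟨u, (hg i).1 hu⟩
    rw [← Subgraph.mem_edgeSet, he] at hv
    exact hv
  simpa using Nat.card_le_card_of_injective g hinj

theorem steinerConn_le_kappaBar [Finite V] (G : SimpleGraph V) (S : Finset V) :
    G.steinerConn S ≤ G.kappaBar S.card := by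
  refine le_csSup (Set.Finite.bddAbove ?_) ⟨S, rfl, rfl⟩
  exact (Set.finite_range fun S : Finset V => G.steinerConn S).subset
    (by rintro m ⟨T, -, rfl⟩; exact ⟨T, rfl⟩)

/-- Two edge-disjoint connected subgraphs with at least four common vertices yield two
internally disjoint Steiner trees on four vertices. -/
theorem two_le_kappaBar_four [Finite V] {G R B : SimpleGraph V} {a b : V}
    (h : G.IsSplit a R B b) (h4 : 4 ≤ (commonReach R B b).ncard) : 2 ≤ G.kappaBar 4 := by
  classical
  have := Fintype.ofFinite V
  obtain ⟨P, hP, hPc, hP4⟩ := (rootSubgraph_connected h.left_le b).exists_le_ncard_inter_eq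
    (by norm_num) {v | B.Reachable b v} h4
  obtain ⟨T, hT, hTv, hTt⟩ := hPc.exists_isTree_le
  obtain ⟨U, hU, hUv, hUt⟩ := (rootSubgraph_connected h.right_le b).exists_isTree_le
  have hUv' : U.verts = {v | B.Reachable b v} := hUv
  set S := P.verts ∩ {v | B.Reachable b v}
  have hTU : T.verts ∩ U.verts = S := by rw [hTv, hUv']
  have hE : T.edgeSet ∩ U.edgeSet = ∅ := by
    rw [Set.eq_empty_iff_forall_notMem]
    intro e
    induction e with
    | h u v =>
      rintro ⟨h1, h2⟩
      exact h.not_adj u v ((hT.trans hP).2 h1).1 (hU.2 h2).1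
  have hnt : S.Nontrivial := by
    rw [← Set.one_lt_ncard_iff_nontrivial]; omega
  have h2 : 2 ≤ G.steinerConn S := by
    refine le_steinerConn hnt (f := ![T, U]) ?_ ?_
    · intro i
      fin_cases i
      · exact ⟨hTU ▸ Set.inter_subset_left, hTt⟩
      · exact ⟨hTU ▸ Set.inter_subset_right, hUt⟩
    · intro i j hij
      fin_cases i <;> fin_cases j
      · exact absurd rfl hij
      · exact ⟨hE, hTU⟩
      · exact ⟨(Set.inter_comm _ _).trans hE, (Set.inter_comm _ _).trans hTU⟩
      · exact absurd rfl hij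
  have h3 := G.steinerConn_le_kappaBar S.toFinset
  rw [← Set.ncard_eq_toFinset_card', hP4, Set.coe_toFinset] at h3
  exact h2.trans h3

end SimpleGraph

/-- If `n = 4r + q` with `r ≥ 1`, `0 ≤ q ≤ 3`, and `G` is a connected graph on
`n` vertices with `κ̄₄(G) = 1`, then `e(G)` is at most `(3n-2)/2`, `(3n-3)/2`, `(3n-4)/2`,
`(3n-3)/2` according as `q = 0, 1, 2, 3`. -/
theorem stmt_12 {V : Type*} [Fintype V] (G : SimpleGraph V) (r q : ℕ) (hr : 1 ≤ r)
    (hq : q ≤ 3) (hcard : Fintype.card V = 4 * r + q) (hG : G.Connected)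
    (hk : G.kappaBar 4 = 1) :
    (q = 0 → G.edgeSet.ncard ≤ (3 * Fintype.card V - 2) / 2) ∧
    (q = 1 → G.edgeSet.ncard ≤ (3 * Fintype.card V - 3) / 2) ∧
    (q = 2 → G.edgeSet.ncard ≤ (3 * Fintype.card V - 4) / 2) ∧
    (q = 3 → G.edgeSet.ncard ≤ (3 * Fintype.card V - 3) / 2) := by
  have hsplit : ∀ R B b, G.IsSplit b R B b → (commonReach R B b).ncard ≤ 3 := by
    intro R B b h
    by_contra! h4
    have := two_le_kappaBar_four h h4
    omega
  obtain ⟨a⟩ := hG.nonempty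
  have h := ncard_edgeSet_atRoot_le hsplit G a le_rfl fun u _ _ => hG.preconnected a u
  have hV : {v | G.Reachable a v}.ncard = Fintype.card V := by
    rw [Set.eq_univ_of_forall (s := {v | G.Reachable a v}) fun v => hG.preconnected a v,
      Set.ncard_univ, Nat.card_eq_fintype_card]
  rw [hV] at h
  omega
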